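/- arXiv:2402.08822 — 3 statements merged into one kernel-verified Lean document; each statement's English description precedes it below -/
import Mathlib

section
/- The element C := D∘D − D − K∘P of E commutes with each of the operators P, D and K, i.e., C∘P = P∘C, C∘D = D∘C and C∘K = K∘C. (C is the operator P̂^t = D² − D − K P^y, a Casimir operator of the Levi factor ⟨P^y, D, K⟩, which therefore lies in the center of the associative algebra Υ_𝔣 generated by P^y, D and K.) -/
open MvPolynomial

/-- The algebra of `ℝ`-linear endomorphisms of the real polynomial ring in two
variables `x := X 0`, `y := X 1`. -/
noncomputable abbrev E : Type := Module.End ℝ (MvPolynomial (Fin 2) ℝ)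

/-- The partial derivative `∂_x` as a linear endomorphism. -/
noncomputable def Dx : E := (pderiv (0 : Fin 2)).toLinearMap

/-- The partial derivative `∂_y` as a linear endomorphism. -/
noncomputable def Dy : E := (pderiv (1 : Fin 2)).toLinearMap

/-- Multiplication by the polynomial `q` as a linear endomorphism. -/
noncomputable def M (q : MvPolynomial (Fin 2) ℝ) : E := LinearMap.mulLeft ℝ q

/-- The Lie-symmetry operator `P = ∂_y`. -/
noncomputable def P : E := Dy

/-- The Lie-symmetry operator `D = x ∂_x + y ∂_y`. -/
noncomputable def D : E := M (X 0) * Dx + M (X 1) * Dy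

/-- The Lie-symmetry operator `K = 2xy ∂_x + y² ∂_y + x`. -/
noncomputable def K : E := M (2 * X 0 * X 1) * Dx + M (X 1 ^ 2) * Dy + M (X 0)

/-- In any ring, `D² - D - KP` commutes with `P`, `D` and `K` as soon as these satisfy the
commutation relations of `sl₂`. -/
theorem casimir_commutes {R : Type*} [Ring R] {p d k : R} (hpd : p * d = d * p + p)
    (hdk : d * k = k * d + k) (hpk : p * k = k * p + 2 * d) :
    (d * d - d - k * p) * p = p * (d * d - d - k * p) ∧
    (d * d - d - k * p) * d = d * (d * d - d - k * p) ∧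
    (d * d - d - k * p) * k = k * (d * d - d - k * p) := by
  have hpd' (a : R) : p * (d * a) = d * (p * a) + p * a := by
    rw [← mul_assoc, hpd, add_mul, mul_assoc]
  have hdk' (a : R) : d * (k * a) = k * (d * a) + k * a := by
    rw [← mul_assoc, hdk, add_mul, mul_assoc]
  have hpk' (a : R) : p * (k * a) = k * (p * a) + 2 * (d * a) := by
    rw [← mul_assoc, hpk, add_mul, mul_assoc, mul_assoc]
  refine ⟨?_, ?_, ?_⟩
  · simp only [mul_assoc, mul_add, mul_sub, sub_mul, hpd, hpd', hpk', two_mul]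
    abel
  · simp only [mul_assoc, mul_add, mul_sub, sub_mul, hpd, hdk']
  · simp only [two_mul, mul_assoc, mul_add, mul_sub, sub_mul, hdk, hpk, hdk']
    abel

theorem pderiv_comm_apply {R σ : Type*} [CommRing R] (i j : σ) (p : MvPolynomial σ R) :
    pderiv i (pderiv j p) = pderiv j (pderiv i p) := by
  classical
  have h : ⁅pderiv (R := R) i, pderiv (R := R) j⁆ = 0 := by
    refine MvPolynomial.derivation_ext fun k => ?_
    simp [Derivation.commutator_apply, pderiv_X, Pi.single_apply, apply_ite]
  simpa [Derivation.commutator_apply, sub_eq_zero] using DFunLike.congr_fun h p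

theorem pderiv_two {R σ : Type*} [CommSemiring R] (i : σ) :
    pderiv i (2 : MvPolynomial σ R) = 0 :=
  (pderiv i).map_natCast 2

theorem P_mul_D : P * D = D * P + P := by
  refine LinearMap.ext fun q => ?_
  simp [P, D, M, Dx, Dy, pderiv_X, pderiv_comm_apply (1 : Fin 2) 0 q]
  ring

theorem D_mul_K : D * K = K * D + K := by
  refine LinearMap.ext fun q => ?_
  simp [D, K, M, Dx, Dy, pderiv_X, Derivation.leibniz_pow, pderiv_two,
    pderiv_comm_apply (1 : Fin 2) 0 q]
  ring

theorem P_mul_K : P * K = K * P + 2 * D := by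
  refine LinearMap.ext fun q => ?_
  simp [P, D, K, M, Dx, Dy, pderiv_X, Derivation.leibniz_pow, pderiv_two,
    pderiv_comm_apply (1 : Fin 2) 0 q]
  ring

/-- The Casimir operator `C = D² − D − K∘P` commutes with `P`, `D` and `K`. -/
theorem stmt_5 :
    (D * D - D - K * P) * P = P * (D * D - D - K * P) ∧
    (D * D - D - K * P) * D = D * (D * D - D - K * P) ∧
    (D * D - D - K * P) * K = K * (D * D - D - K * P) :=
  casimir_commutes P_mul_D D_mul_K P_mul_K
end

section
/- Let μ ∈ ℝ and set μ̃ := 4μ + 3/4. Let ϑ : ℝ → ℝ → ℝ be a smooth function satisfying the (1+1)-dimensional linear heat equation with inverse square potential, ∂ϑ/∂z₁(z₁,z₂) = ∂²ϑ/∂z₂²(z₁,z₂) − μ̃·z₂^{−2}·ϑ(z₁,z₂), for all z₁ ∈ ℝ and z₂ > 0. Then the function u(t,x,y) := exp(μt)·x^{1/4}·ϑ(y, 2√x) is a solution of the fine Kolmogorov backward equation on the open set {(t,x,y) ∈ ℝ³ : x > 0}. -/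
open Real Set

/-- Partial derivative with respect to the first (time) variable. -/
noncomputable def pdt (u : ℝ × ℝ × ℝ → ℝ) (p : ℝ × ℝ × ℝ) : ℝ :=
  deriv (fun s => u (s, p.2.1, p.2.2)) p.1

/-- Partial derivative with respect to the second (space, `x`) variable. -/
noncomputable def pdx (u : ℝ × ℝ × ℝ → ℝ) (p : ℝ × ℝ × ℝ) : ℝ :=
  deriv (fun s => u (p.1, s, p.2.2)) p.2.1

/-- Partial derivative with respect to the third (`y`) variable. -/
noncomputable def pdy (u : ℝ × ℝ × ℝ → ℝ) (p : ℝ × ℝ × ℝ) : ℝ :=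
  deriv (fun s => u (p.1, p.2.1, s)) p.2.2

/-- Second partial derivative with respect to `x`. -/
noncomputable def pdxx (u : ℝ × ℝ × ℝ → ℝ) (p : ℝ × ℝ × ℝ) : ℝ :=
  deriv (fun s => deriv (fun r => u (p.1, r, p.2.2)) s) p.2.1

/-- `u` is a (smooth) solution of the fine Kolmogorov backward equation
`u_t + x u_y = x² u_xx` on the set `Ω`. -/
def IsSolutionOn (u : ℝ × ℝ × ℝ → ℝ) (Ω : Set (ℝ × ℝ × ℝ)) : Prop :=
  ContDiffOn ℝ (⊤ : ℕ∞) u Ω ∧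
    ∀ p ∈ Ω, pdt u p + p.2.1 * pdy u p = p.2.1 ^ 2 * pdxx u p

theorem hasDerivAt_rpow_quarter {r : ℝ} (hr : 0 < r) :
    HasDerivAt (fun r : ℝ => r ^ ((1 : ℝ) / 4)) (r ^ ((1 : ℝ) / 4) / (4 * r)) r := by
  have h := Real.hasDerivAt_rpow_const (x := r) (p := (1 : ℝ) / 4) (Or.inl hr.ne')
  rw [Real.rpow_sub_one hr.ne'] at h
  convert h using 1
  field_simp

theorem HasDerivAt.comp_two_mul_sqrt {f : ℝ → ℝ} {f' r : ℝ} (hr : 0 < r)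
    (hf : HasDerivAt f f' (2 * √r)) :
    HasDerivAt (fun r => f (2 * √r)) (f' / √r) r := by
  refine (hf.comp r ((Real.hasDerivAt_sqrt hr.ne').const_mul 2)).congr_deriv ?_
  have := (Real.sqrt_pos.2 hr).ne'
  field_simp

theorem hasDerivAt_rpow_quarter_mul_comp {f : ℝ → ℝ} {f' r : ℝ} (C : ℝ) (hr : 0 < r)
    (hf : HasDerivAt f f' (2 * √r)) :
    HasDerivAt (fun r => C * r ^ ((1 : ℝ) / 4) * f (2 * √r))
      (C * r ^ ((1 : ℝ) / 4) * (f (2 * √r) / (4 * r) + f' / √r)) r := by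
  refine (((hasDerivAt_rpow_quarter hr).const_mul C).mul
    (hf.comp_two_mul_sqrt hr)).congr_deriv ?_
  have := (Real.sqrt_pos.2 hr).ne'
  field_simp

theorem deriv_deriv_rpow_quarter_mul_comp {f : ℝ → ℝ} {x : ℝ} (C : ℝ) (hx : 0 < x)
    (hf : Differentiable ℝ f) (hf' : Differentiable ℝ (deriv f)) :
    deriv (fun s => deriv (fun r => C * r ^ ((1 : ℝ) / 4) * f (2 * √r)) s) x =
      C * x ^ ((1 : ℝ) / 4) *
        (deriv (deriv f) (2 * √x) / x - 3 / 16 * f (2 * √x) / x ^ 2) := by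
  have hev : (fun s => deriv (fun r => C * r ^ ((1 : ℝ) / 4) * f (2 * √r)) s) =ᶠ[nhds x]
      fun r => C * r ^ ((1 : ℝ) / 4) * (f (2 * √r) / (4 * r) + deriv f (2 * √r) / √r) := by
    filter_upwards [lt_mem_nhds hx] with r hr
    exact (hasDerivAt_rpow_quarter_mul_comp C hr (hf _).hasDerivAt).deriv
  rw [hev.deriv_eq]
  have hs := Real.sqrt_pos.2 hx
  have hF := (hf (2 * √x)).hasDerivAt.comp_two_mul_sqrt hx
  have hF' := (hf' (2 * √x)).hasDerivAt.comp_two_mul_sqrt hx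
  have h := ((hasDerivAt_rpow_quarter hx).const_mul C).mul
    ((hF.div ((hasDerivAt_id x).const_mul 4) (by simpa using hx.ne')).add
      (hF'.div (Real.hasDerivAt_sqrt hx.ne') hs.ne'))
  refine h.deriv.trans ?_
  simp only [Pi.add_apply, Pi.div_apply, id]
  generalize x ^ ((1 : ℝ) / 4) = q
  have hsq : x = √x ^ 2 := (Real.sq_sqrt hx.le).symm
  generalize √x = s at *
  subst hsq
  field_simp
  ring

/-- For any smooth solution `ϑ` of the (1+1)-dimensional linear heat equation with
inverse square potential `μ̃ z₂⁻²`, where `μ̃ = 4μ + 3/4`, the function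
`u(t,x,y) = e^{μt} x^{1/4} ϑ(y, 2√x)` solves the fine Kolmogorov backward equation
on `{x > 0}`. -/
theorem stmt_11 (μ : ℝ) (ϑ : ℝ → ℝ → ℝ)
    (hϑ : ContDiff ℝ (⊤ : ℕ∞) fun q : ℝ × ℝ => ϑ q.1 q.2)
    (hpot : ∀ z1 z2 : ℝ, 0 < z2 →
      deriv (fun s => ϑ s z2) z1 =
        deriv (deriv (ϑ z1)) z2 - (4 * μ + 3 / 4) * z2⁻¹ ^ 2 * ϑ z1 z2) :
    IsSolutionOn
      (fun p : ℝ × ℝ × ℝ =>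
        Real.exp (μ * p.1) * p.2.1 ^ ((1 : ℝ) / 4) * ϑ p.2.2 (2 * Real.sqrt p.2.1))
      {p : ℝ × ℝ × ℝ | 0 < p.2.1} := by
  have hslice (y : ℝ) : ContDiff ℝ (⊤ : ℕ∞) (ϑ y) :=
    hϑ.comp (contDiff_const.prodMk contDiff_id)
  constructor
  · intro p hp
    have hp : p.2.1 ≠ 0 := ne_of_gt hp
    have hx : ContDiffAt ℝ (⊤ : ℕ∞) (fun p : ℝ × ℝ × ℝ => p.2.1) p := by fun_prop
    have hy : ContDiffAt ℝ (⊤ : ℕ∞) (fun p : ℝ × ℝ × ℝ => p.2.2) p := by fun_prop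
    have hexp : ContDiffAt ℝ (⊤ : ℕ∞) (fun p : ℝ × ℝ × ℝ => Real.exp (μ * p.1)) p := by
      fun_prop
    exact ((hexp.mul (hx.rpow_const_of_ne hp)).mul
      (hϑ.contDiffAt.comp p (hy.prodMk (contDiffAt_const.mul (hx.sqrt hp))))).contDiffWithinAt
  · rintro ⟨t, x, y⟩ (hx : 0 < x)
    have hd : Differentiable ℝ (ϑ y) := (hslice y).differentiable (by simp)
    have hd' : Differentiable ℝ (deriv (ϑ y)) :=
      (contDiff_infty_iff_deriv.1 (hslice y)).2.differentiable (by simp)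
    have ht : HasDerivAt (fun s => Real.exp (μ * s)) (Real.exp (μ * t) * μ) t := by
      simpa using ((hasDerivAt_id t).const_mul μ).exp
    simp only [pdt, pdy, pdxx]
    rw [deriv_deriv_rpow_quarter_mul_comp _ hx hd hd', ((ht.mul_const _).mul_const _).deriv,
      deriv_const_mul_field, hpot y _ (by positivity), inv_pow, mul_pow, Real.sq_sqrt hx.le]
    field_simp
    ring
end

section
/- Fix an integer n ≥ 1 and a smooth solution θ : ℝ → ℝ → ℝ of the (1+1)-dimensional linear heat equation. For an integer k ≥ 1 let A_k denote the operator sending a smooth function f : ℝ → ℝ → ℝ to (z₁,z₂) ↦ 2k·∂f/∂z₂(z₁,z₂) + k²·f(z₁,z₂), and for 0 ≤ s ≤ n−1 set φ_s := (A_{n−s} ∘ A_{n−s+1} ∘ ⋯ ∘ A_{n−1}) θ (the empty composition, s = 0, being the identity). Then the function u(t,x,y) := exp(−t/4)·x^{n−1/2}·Σ_{s=0}^{n−1} (y^s·x^{−s}/s!)·φ_s(t, ln x) is a solution of the fine Kolmogorov backward equation on the open set {(t,x,y) ∈ ℝ³ : x > 0}. -/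
open Real Set

/-- The operator `A_k` sending `f` to `(z₁,z₂) ↦ 2k ∂f/∂z₂ + k² f`. -/
noncomputable def Aop (k : ℕ) (f : ℝ → ℝ → ℝ) : ℝ → ℝ → ℝ :=
  fun z1 z2 => 2 * (k : ℝ) * deriv (f z1) z2 + (k : ℝ) ^ 2 * f z1 z2

/-- `compA n θ s = (A_{n−s} ∘ A_{n−s+1} ∘ ⋯ ∘ A_{n−1}) θ`, the empty composition
(`s = 0`) being the identity. -/
noncomputable def compA (n : ℕ) (θ : ℝ → ℝ → ℝ) : ℕ → ℝ → ℝ → ℝ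
  | 0 => θ
  | s + 1 => Aop (n - s - 1) (compA n θ s)

section PartialDerivatives

variable {f : ℝ → ℝ → ℝ}

theorem hasDerivAt_fst_of_contDiff (hf : ContDiff ℝ (⊤ : ℕ∞) fun q : ℝ × ℝ => f q.1 q.2)
    (z₁ z₂ : ℝ) :
    HasDerivAt (fun s => f s z₂) (fderiv ℝ (fun q : ℝ × ℝ => f q.1 q.2) (z₁, z₂) (1, 0)) z₁ := by
  have h : HasFDerivAt (fun q : ℝ × ℝ => f q.1 q.2) _ (z₁, z₂) :=
    (hf.differentiable (by simp) (z₁, z₂)).hasFDerivAt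
  exact h.comp_hasDerivAt z₁ ((hasDerivAt_id z₁).prodMk (hasDerivAt_const z₁ z₂))

theorem hasDerivAt_snd_of_contDiff (hf : ContDiff ℝ (⊤ : ℕ∞) fun q : ℝ × ℝ => f q.1 q.2)
    (z₁ z₂ : ℝ) :
    HasDerivAt (f z₁) (fderiv ℝ (fun q : ℝ × ℝ => f q.1 q.2) (z₁, z₂) (0, 1)) z₂ := by
  have h : HasFDerivAt (fun q : ℝ × ℝ => f q.1 q.2) _ (z₁, z₂) :=
    (hf.differentiable (by simp) (z₁, z₂)).hasFDerivAt
  exact h.comp_hasDerivAt z₂ ((hasDerivAt_const z₂ z₁).prodMk (hasDerivAt_id z₂))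

theorem differentiable_fst_of_contDiff (hf : ContDiff ℝ (⊤ : ℕ∞) fun q : ℝ × ℝ => f q.1 q.2)
    (z₂ : ℝ) : Differentiable ℝ fun s => f s z₂ :=
  fun z₁ => (hasDerivAt_fst_of_contDiff hf z₁ z₂).differentiableAt

theorem differentiable_snd_of_contDiff (hf : ContDiff ℝ (⊤ : ℕ∞) fun q : ℝ × ℝ => f q.1 q.2)
    (z₁ : ℝ) : Differentiable ℝ (f z₁) :=
  fun z₂ => (hasDerivAt_snd_of_contDiff hf z₁ z₂).differentiableAt

theorem contDiff_deriv_snd (hf : ContDiff ℝ (⊤ : ℕ∞) fun q : ℝ × ℝ => f q.1 q.2) :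
    ContDiff ℝ (⊤ : ℕ∞) fun q : ℝ × ℝ => deriv (f q.1) q.2 := by
  have h : (fun q : ℝ × ℝ => deriv (f q.1) q.2) =
      fun q => fderiv ℝ (fun q : ℝ × ℝ => f q.1 q.2) q (0, 1) :=
    funext fun q => (hasDerivAt_snd_of_contDiff hf q.1 q.2).deriv
  rw [h]
  exact (hf.fderiv_right (by simp)).clm_apply contDiff_const

theorem deriv_deriv_comm (hf : ContDiff ℝ (⊤ : ℕ∞) fun q : ℝ × ℝ => f q.1 q.2) (z₁ z₂ : ℝ) :
    deriv (fun s => deriv (f s) z₂) z₁ = deriv (fun r => deriv (fun s => f s r) z₁) z₂ := by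
  set F : ℝ × ℝ → ℝ := fun q => f q.1 q.2 with hF
  have hd : HasFDerivAt (fderiv ℝ F) (fderiv ℝ (fderiv ℝ F) (z₁, z₂)) (z₁, z₂) :=
    ((hf.fderiv_right (m := 1) (by norm_cast)).differentiable (by simp) _).hasFDerivAt
  have h₁ : HasDerivAt (fun s => fderiv ℝ F (s, z₂) (0, 1))
      (fderiv ℝ (fderiv ℝ F) (z₁, z₂) (1, 0) (0, 1)) z₁ :=
    (ContinuousLinearMap.apply ℝ ℝ ((0, 1) : ℝ × ℝ)).hasFDerivAt.comp_hasDerivAt z₁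
      (hd.comp_hasDerivAt z₁ ((hasDerivAt_id z₁).prodMk (hasDerivAt_const z₁ z₂)))
  have h₂ : HasDerivAt (fun r => fderiv ℝ F (z₁, r) (1, 0))
      (fderiv ℝ (fderiv ℝ F) (z₁, z₂) (0, 1) (1, 0)) z₂ :=
    (ContinuousLinearMap.apply ℝ ℝ ((1, 0) : ℝ × ℝ)).hasFDerivAt.comp_hasDerivAt z₂
      (hd.comp_hasDerivAt z₂ ((hasDerivAt_const z₂ z₁).prodMk (hasDerivAt_id z₂)))
  simp only [fun s => (hasDerivAt_snd_of_contDiff hf s z₂).deriv,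
    fun r => (hasDerivAt_fst_of_contDiff hf z₁ r).deriv]
  rw [h₁.deriv, h₂.deriv]
  exact (hf.contDiffAt.isSymmSndFDerivAt
    (by rw [minSmoothness_of_isRCLikeNormedField]; exact WithTop.coe_le_coe.2 (le_top (a := (2 : ℕ∞))))) _ _

end PartialDerivatives

/-- Smooth solutions of the heat equation `∂f/∂z₁ = ∂²f/∂z₂²` on the plane. -/
structure IsHeatSolution (f : ℝ → ℝ → ℝ) : Prop where
  contDiff : ContDiff ℝ (⊤ : ℕ∞) fun q : ℝ × ℝ => f q.1 q.2
  heat : ∀ z₁ z₂ : ℝ, deriv (fun s => f s z₂) z₁ = deriv (deriv (f z₁)) z₂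

namespace IsHeatSolution

variable {f g : ℝ → ℝ → ℝ}

theorem deriv_snd (hf : IsHeatSolution f) : IsHeatSolution fun z₁ z₂ => deriv (f z₁) z₂ where
  contDiff := contDiff_deriv_snd hf.contDiff
  heat z₁ z₂ := by
    rw [deriv_deriv_comm hf.contDiff]
    simp only [hf.heat]

theorem const_mul (hf : IsHeatSolution f) (c : ℝ) : IsHeatSolution fun z₁ z₂ => c * f z₁ z₂ where
  contDiff := contDiff_const.mul hf.contDiff
  heat z₁ z₂ := by
    have h : deriv (fun r => c * f z₁ r) = fun r => c * deriv (f z₁) r :=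
      funext fun r => deriv_const_mul_field c
    rw [h, deriv_const_mul_field, deriv_const_mul_field, hf.heat]

theorem add (hf : IsHeatSolution f) (hg : IsHeatSolution g) :
    IsHeatSolution fun z₁ z₂ => f z₁ z₂ + g z₁ z₂ where
  contDiff := hf.contDiff.add hg.contDiff
  heat z₁ z₂ := by
    have h : deriv (fun r => f z₁ r + g z₁ r) = fun r => deriv (f z₁) r + deriv (g z₁) r :=
      funext fun r => deriv_fun_add (differentiable_snd_of_contDiff hf.contDiff z₁ r)
        (differentiable_snd_of_contDiff hg.contDiff z₁ r)
    rw [h, deriv_fun_add (differentiable_fst_of_contDiff hf.contDiff z₂ z₁)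
        (differentiable_fst_of_contDiff hg.contDiff z₂ z₁),
      hf.heat, hg.heat]
    have hf' := differentiable_snd_of_contDiff (f := fun z₁ z₂ => deriv (f z₁) z₂)
      hf.deriv_snd.contDiff z₁
    have hg' := differentiable_snd_of_contDiff (f := fun z₁ z₂ => deriv (g z₁) z₂)
      hg.deriv_snd.contDiff z₁
    exact (deriv_fun_add (hf' z₂) (hg' z₂)).symm

theorem aop (hf : IsHeatSolution f) (k : ℕ) : IsHeatSolution (Aop k f) :=
  (hf.deriv_snd.const_mul _).add (hf.const_mul _)

theorem compA (hf : IsHeatSolution f) (n s : ℕ) : IsHeatSolution (compA n f s) := by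
  induction s with
  | zero => exact hf
  | succ s ih => exact ih.aop _

end IsHeatSolution

theorem hasDerivAt_rpow_mul_comp_log (a : ℝ) {g : ℝ → ℝ} (hg : Differentiable ℝ g) {x : ℝ}
    (hx : 0 < x) :
    HasDerivAt (fun r => r ^ a * g (Real.log r))
      (x ^ (a - 1) * (a * g (Real.log x) + deriv g (Real.log x))) x := by
  have h := (Real.hasDerivAt_rpow_const (p := a) (Or.inl hx.ne')).mul
    ((hg (Real.log x)).hasDerivAt.comp x (Real.hasDerivAt_log hx.ne'))
  refine h.congr_deriv ?_
  rw [Function.comp_apply, Real.rpow_sub_one hx.ne']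
  field_simp

theorem rpow_mul_zpow_neg_natCast {x : ℝ} (hx : 0 < x) (a : ℝ) (s : ℕ) :
    x ^ a * x ^ (-(s : ℤ)) = x ^ (a - s) := by
  rw [← Real.rpow_intCast, ← Real.rpow_add hx]
  push_cast
  rw [sub_eq_add_neg]

theorem exp_mul_rpow_mul_sum_eq {x : ℝ} (hx : 0 < x) (E a y : ℝ) (n : ℕ) (c : ℕ → ℝ) :
    E * x ^ a * ∑ s ∈ Finset.range n, y ^ s * x ^ (-(s : ℤ)) / (Nat.factorial s : ℝ) * c s =
      ∑ s ∈ Finset.range n, E * (y ^ s / (Nat.factorial s : ℝ)) * (x ^ (a - s) * c s) := by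
  rw [Finset.mul_sum]
  refine Finset.sum_congr rfl fun s _ => ?_
  rw [← rpow_mul_zpow_neg_natCast hx a s]
  ring

theorem hasDerivAt_sum_pow_div_factorial (n : ℕ) (c : ℕ → ℝ) (y : ℝ) :
    HasDerivAt (fun r => ∑ s ∈ Finset.range (n + 1), r ^ s / (Nat.factorial s : ℝ) * c s)
      (∑ s ∈ Finset.range n, y ^ s / (Nat.factorial s : ℝ) * c (s + 1)) y := by
  have h : HasDerivAt (fun r => ∑ s ∈ Finset.range (n + 1), r ^ s / (Nat.factorial s : ℝ) * c s)
      (∑ s ∈ Finset.range (n + 1), (s * y ^ (s - 1)) / (Nat.factorial s : ℝ) * c s) y :=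
    HasDerivAt.fun_sum fun s _ => ((hasDerivAt_pow s y).div_const _).mul_const _
  convert h using 1
  rw [Finset.sum_range_succ']
  simp only [Nat.factorial_succ, Nat.add_sub_cancel, Nat.cast_mul, Nat.cast_zero, zero_mul,
    zero_div, add_zero]
  refine Finset.sum_congr rfl fun s _ => ?_
  have h₁ : ((s + 1 : ℕ) : ℝ) ≠ 0 := by positivity
  rw [mul_div_mul_left _ _ h₁]

/-- The essential solutions obtained by generalized reduction of the fine Kolmogorov
backward equation with respect to `(D_y^n u)∂_u`:
`u = e^{-t/4} x^{n-1/2} Σ_{s=0}^{n-1} (yˢ x⁻ˢ/s!) φ_s(t, ln x)` with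
`φ_s = (A_{n−s}⋯A_{n−1})θ` is a solution on `{x > 0}`. -/
theorem stmt_15 (n : ℕ) (hn : 1 ≤ n) (θ : ℝ → ℝ → ℝ)
    (hθ : ContDiff ℝ (⊤ : ℕ∞) fun q : ℝ × ℝ => θ q.1 q.2)
    (hheat : ∀ z1 z2 : ℝ, deriv (fun s => θ s z2) z1 = deriv (deriv (θ z1)) z2) :
    IsSolutionOn
      (fun p : ℝ × ℝ × ℝ =>
        Real.exp (-p.1 / 4) * p.2.1 ^ ((n : ℝ) - 1 / 2) *
          ∑ s ∈ Finset.range n,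
            p.2.2 ^ s * p.2.1 ^ (-(s : ℤ)) / (Nat.factorial s : ℝ) *
              compA n θ s p.1 (Real.log p.2.1))
      {p : ℝ × ℝ × ℝ | 0 < p.2.1} := by
  have hφ : ∀ s, IsHeatSolution (compA n θ s) := (IsHeatSolution.mk hθ hheat).compA n
  have hlast : ∀ z₁ z₂, compA n θ n z₁ z₂ = 0 := by
    intro z₁ z₂
    obtain ⟨m, rfl⟩ : ∃ m, n = m + 1 := ⟨n - 1, by omega⟩
    simp [compA, Aop]
  refine ⟨?_, ?_⟩
  · refine ContDiffOn.congr (f := fun p : ℝ × ℝ × ℝ => ∑ s ∈ Finset.range n,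
      Real.exp (-p.1 / 4) * (p.2.2 ^ s / (Nat.factorial s : ℝ)) *
        (p.2.1 ^ ((n : ℝ) - 1 / 2 - s) * compA n θ s p.1 (Real.log p.2.1))) ?_
      fun p hp => exp_mul_rpow_mul_sum_eq hp _ _ _ _ _
    intro p hp
    have hp' : p.2.1 ≠ 0 := ne_of_gt hp
    have hx : ContDiffAt ℝ (⊤ : ℕ∞) (fun p : ℝ × ℝ × ℝ => p.2.1) p := by fun_prop
    refine (ContDiffAt.sum fun s _ => ?_).contDiffWithinAt
    have hlog := (hφ s).contDiff.contDiffAt.comp p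
      ((contDiff_fst.contDiffAt (x := p)).prodMk (hx.log hp'))
    refine ContDiffAt.mul (by fun_prop) ((hx.rpow_const_of_ne hp').mul hlog)
  · rintro ⟨t, x, y⟩ (hx : 0 < x)
    have ht : HasDerivAt (fun r => ∑ s ∈ Finset.range n, Real.exp (-r / 4) *
        (y ^ s / (Nat.factorial s : ℝ)) *
          (x ^ ((n : ℝ) - 1 / 2 - s) * compA n θ s r (Real.log x)))
        (∑ s ∈ Finset.range n, Real.exp (-t / 4) * (y ^ s / (Nat.factorial s : ℝ)) *
          (x ^ ((n : ℝ) - 1 / 2 - s) * (deriv (deriv (compA n θ s t)) (Real.log x)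
            - 1 / 4 * compA n θ s t (Real.log x)))) t := by
      refine HasDerivAt.fun_sum fun s _ => ?_
      have hE : HasDerivAt (fun r : ℝ => Real.exp (-r / 4)) (Real.exp (-t / 4) * (-1 / 4)) t :=
        (((hasDerivAt_id t).neg).div_const 4).exp
      have hc := (differentiable_fst_of_contDiff (hφ s).contDiff (Real.log x) t).hasDerivAt
      rw [(hφ s).heat] at hc
      refine ((hE.mul_const _).mul (hc.const_mul _)).congr_deriv ?_
      ring
    have hy : HasDerivAt (fun r => ∑ s ∈ Finset.range n, Real.exp (-t / 4) *
        (r ^ s / (Nat.factorial s : ℝ)) *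
          (x ^ ((n : ℝ) - 1 / 2 - s) * compA n θ s t (Real.log x)))
        (∑ s ∈ Finset.range n, Real.exp (-t / 4) * (y ^ s / (Nat.factorial s : ℝ)) *
          (x ^ ((n : ℝ) - 1 / 2 - s - 1) * compA n θ (s + 1) t (Real.log x))) y := by
      have h := hasDerivAt_sum_pow_div_factorial n (fun s => Real.exp (-t / 4) *
        (x ^ ((n : ℝ) - 1 / 2 - s) * compA n θ s t (Real.log x))) y
      simp only [Finset.sum_range_succ _ n, hlast, mul_zero, add_zero] at h
      convert h using 1
      · funext r
        exact Finset.sum_congr rfl fun s _ => by ring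
      · refine Finset.sum_congr rfl fun s _ => ?_
        push_cast
        rw [sub_sub _ (s : ℝ) 1]
        ring
    have hx₁ : ∀ r, 0 < r → HasDerivAt (fun r => ∑ s ∈ Finset.range n, Real.exp (-t / 4) *
        (y ^ s / (Nat.factorial s : ℝ)) *
          (r ^ ((n : ℝ) - 1 / 2 - s) * compA n θ s t (Real.log r)))
        (∑ s ∈ Finset.range n, Real.exp (-t / 4) * (y ^ s / (Nat.factorial s : ℝ)) *
          (r ^ ((n : ℝ) - 1 / 2 - s - 1) * (((n : ℝ) - 1 / 2 - s) * compA n θ s t (Real.log r)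
            + deriv (compA n θ s t) (Real.log r)))) r := fun r hr =>
      HasDerivAt.fun_sum fun s _ => (hasDerivAt_rpow_mul_comp_log _
        (differentiable_snd_of_contDiff (hφ s).contDiff t) hr).const_mul _
    have hx₂ : HasDerivAt (fun r => ∑ s ∈ Finset.range n, Real.exp (-t / 4) *
        (y ^ s / (Nat.factorial s : ℝ)) *
          (r ^ ((n : ℝ) - 1 / 2 - s - 1) * (((n : ℝ) - 1 / 2 - s) * compA n θ s t (Real.log r)
            + deriv (compA n θ s t) (Real.log r))))
        (∑ s ∈ Finset.range n, Real.exp (-t / 4) * (y ^ s / (Nat.factorial s : ℝ)) *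
          (x ^ ((n : ℝ) - 1 / 2 - s - 1 - 1) * (((n : ℝ) - 1 / 2 - s - 1) *
            (((n : ℝ) - 1 / 2 - s) * compA n θ s t (Real.log x)
              + deriv (compA n θ s t) (Real.log x)) +
            (((n : ℝ) - 1 / 2 - s) * deriv (compA n θ s t) (Real.log x)
              + deriv (deriv (compA n θ s t)) (Real.log x))))) x := by
      refine HasDerivAt.fun_sum fun s _ => ?_
      have hd := differentiable_snd_of_contDiff (hφ s).contDiff t
      have hdd : Differentiable ℝ (deriv (compA n θ s t)) :=
        differentiable_snd_of_contDiff (f := fun z₁ z₂ => deriv (compA n θ s z₁) z₂)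
          (hφ s).deriv_snd.contDiff t
      have h := hasDerivAt_rpow_mul_comp_log ((n : ℝ) - 1 / 2 - s - 1)
        ((hd.const_mul ((n : ℝ) - 1 / 2 - s)).add hdd) hx
      rw [deriv_add (hd.const_mul _ _) (hdd _), deriv_const_mul_field] at h
      exact h.const_mul _
    have hxx := hx₂.congr_of_eventuallyEq (f₁ := deriv fun r =>
        Real.exp (-t / 4) * r ^ ((n : ℝ) - 1 / 2) * ∑ s ∈ Finset.range n,
          y ^ s * r ^ (-(s : ℤ)) / (Nat.factorial s : ℝ) * compA n θ s t (Real.log r)) <| by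
      filter_upwards [lt_mem_nhds hx] with r hr
      refine HasDerivAt.deriv ((hx₁ r hr).congr_of_eventuallyEq ?_)
      filter_upwards [lt_mem_nhds hr] with q hq
      exact exp_mul_rpow_mul_sum_eq hq _ _ _ _ _
    simp only [pdt, pdy, pdxx]
    rw [hxx.deriv]
    simp only [exp_mul_rpow_mul_sum_eq hx]
    rw [ht.deriv, hy.deriv, Finset.mul_sum, Finset.mul_sum, ← Finset.sum_add_distrib]
    refine Finset.sum_congr rfl fun s hs => ?_
    have hk : ((n - s - 1 : ℕ) : ℝ) = (n : ℝ) - s - 1 := by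
      have := Finset.mem_range.mp hs
      rw [Nat.cast_sub (by omega), Nat.cast_sub (by omega), Nat.cast_one]
    simp only [compA, Aop, hk, Real.rpow_sub_one hx.ne']
    field_simp
    ring
end
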